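/- For all τ, η ∈ OP_n, the Weisner coefficient satisfies: w(τ,η) = (−1)^{|τ|−asc_η(τ)−1} / ( |τ| · C(|τ|−1, asc_η(τ)) ) if τ̄ ≤ η̄, and w(τ,η) = 0 if τ̄ ≰ η̄, where C denotes the binomial coefficient. -/

import Mathlib

open Finset

namespace OSPpaper

/-- A *block* is a subset of `[n] = Fin n`. -/
abbrev Block (n : ℕ) := Finset (Fin n)

/-- `l` is an ordered set partition of the ground set `E ⊆ [n]`:
a finite sequence of pairwise disjoint nonempty subsets of `E` whose union is `E`. -/
def IsOSP {n : ℕ} (E : Finset (Fin n)) (l : List (Block n)) : Prop :=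
  (∀ P ∈ l, P.Nonempty) ∧ l.Pairwise (fun P Q => Disjoint P Q) ∧
    (∀ P ∈ l, P ⊆ E) ∧ ∀ i ∈ E, ∃ P ∈ l, i ∈ P

/-- Union of a list of blocks. -/
def unionList {n : ℕ} (l : List (Block n)) : Block n := l.foldr (· ∪ ·) ∅

/-- The order on ordered set partitions: `π ≤ σ` iff every block of `σ` is the union
of a contiguous run of blocks of `π` (runs taken in order). -/
def OSPle {n : ℕ} (π σ : List (Block n)) : Prop :=
  ∃ L : List (List (Block n)), L.flatten = π ∧ σ = L.map unionList

/-- The restriction `σ⌋_P`: intersect every block with `P` and delete the empty intersections. -/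
def restrict {n : ℕ} (σ : List (Block n)) (P : Block n) : List (Block n) :=
  (σ.map (fun Q => Q ∩ P)).filter (fun Q => decide (Q ≠ ∅))

/-- The quasi-meet `π ⋏ σ`: the concatenation `σ⌋_{P₁} σ⌋_{P₂} ⋯ σ⌋_{P_p}`. -/
def qmeet {n : ℕ} (π σ : List (Block n)) : List (Block n) :=
  (π.map (fun P => restrict σ P)).flatten

/-- Refinement: every block of `σ` is contained in some block of `τ`.
(As a relation on the underlying unordered partitions, this is the refinement order;
in particular `refines τ η` says `τ̄ ≤ η̄`.) -/
def refines {n : ℕ} (σ τ : List (Block n)) : Prop := ∀ P ∈ σ, ∃ Q ∈ τ, P ⊆ Q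

/-- An interval partition of `[m]`, with its blocks listed in (the unique) increasing order:
an ordered set partition whose consecutive blocks are completely ordered. -/
def IsIP {m : ℕ} (l : List (Finset (Fin m))) : Prop :=
  IsOSP Finset.univ l ∧ l.Chain' (fun P Q => ∀ a ∈ P, ∀ b ∈ Q, a < b)

/-- The (0-based) index `π(k)` of the block of `π` containing `k`. -/
def blockIdx {n : ℕ} (π : List (Block n)) (k : Fin n) : ℕ :=
  π.findIdx (fun P => decide (k ∈ P))

/-- The ordered kernel `κ(i₁,…,iₙ)` of a tuple: the nonempty level sets of the tuple,
listed in increasing order of the value. -/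
def kernel {n : ℕ} (i : Fin n → ℕ) : List (Block n) :=
  ((Finset.image i Finset.univ).sort (· ≤ ·)).map
    (fun v => Finset.univ.filter (fun k => i k = v))

/-- `[σ:π] = ∏_{P ∈ π} #(σ⌋_P)`. -/
def colonNum {n : ℕ} (σ π : List (Block n)) : ℕ :=
  (π.map (fun P => (restrict σ P).length)).prod

/-- `[σ:π]! = ∏_{P ∈ π} #(σ⌋_P)!`. -/
def colonFac {n : ℕ} (σ π : List (Block n)) : ℕ :=
  (π.map (fun P => Nat.factorial (restrict σ P).length)).prod

/-- For `τ̄ ≤ η̄` the sequence `(m_1,…,m_s)`: `m_i` is the (0-based) index of the block of `η`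
containing the `i`-th block of `τ`. -/
def mseq {n : ℕ} (τ η : List (Block n)) : List ℕ :=
  τ.map (fun T => η.findIdx (fun E => decide (T ⊆ E)))

/-- number of ascents of a sequence -/
def ascL (l : List ℕ) : ℕ := ((l.zip l.tail).filter (fun p => decide (p.1 < p.2))).length
/-- number of descents of a sequence -/
def desL (l : List ℕ) : ℕ := ((l.zip l.tail).filter (fun p => decide (p.2 < p.1))).length
/-- number of plateaux of a sequence -/
def platL (l : List ℕ) : ℕ := ((l.zip l.tail).filter (fun p => decide (p.1 = p.2))).length

/-- `asc_η(τ)` -/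
def ascN {n : ℕ} (τ η : List (Block n)) : ℕ := ascL (mseq τ η)
/-- `des_η(τ)` -/
def desN {n : ℕ} (τ η : List (Block n)) : ℕ := desL (mseq τ η)
/-- `plat_η(τ)` -/
def platN {n : ℕ} (τ η : List (Block n)) : ℕ := platL (mseq τ η)

/-- lengths of the maximal ascending runs of a sequence -/
def ascRunLengths (l : List ℕ) : List ℕ :=
  (l.splitBy (fun a b => decide (a < b))).map List.length
/-- lengths of the maximal level (constant) runs of a sequence -/
def levelRunLengths (l : List ℕ) : List ℕ :=
  (l.splitBy (fun a b => decide (a = b))).map List.length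

/-- `μ̃(σ,π) = (−1)^{|σ|−|π|} / [σ:π]` (real-valued). -/
noncomputable def muR {n : ℕ} (σ π : List (Block n)) : ℝ :=
  (-1 : ℝ) ^ (σ.length - π.length) / (colonNum σ π : ℝ)

/-- `ζ̃(σ,π) = 1 / [σ:π]!` (real-valued). -/
noncomputable def zetaR {n : ℕ} (σ π : List (Block n)) : ℝ :=
  1 / (colonFac σ π : ℝ)

/-- The Weisner coefficient `w(τ,η) = ∑_{σ ⋏ η = τ} μ̃(σ, 1̂ₙ)`. -/
noncomputable def wcoef {n : ℕ} (τ η : List (Block n)) : ℝ :=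
  ∑ᶠ σ ∈ {σ : List (Block n) | IsOSP Finset.univ σ ∧ qmeet σ η = τ},
    muR σ [(Finset.univ : Block n)]

/-- The Goldberg coefficient `g(τ,η) = ∑_{σ ≥ τ} ζ̃(τ,σ) w(σ,η)`. -/
noncomputable def gcoef {n : ℕ} (τ η : List (Block n)) : ℝ :=
  ∑ᶠ σ ∈ {σ : List (Block n) | IsOSP Finset.univ σ ∧ OSPle τ σ}, zetaR τ σ * wcoef σ η

section ListRuns

variable {α : Type*} [DecidableEq α]

/-- All ways of cutting a list into nonempty consecutive pieces each of which is an `R`-chain. -/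
def chainRuns (R : α → α → Prop) [DecidableRel R] : List α → Finset (List (List α))
  | [] => {[]}
  | [a] => {[[a]]}
  | a :: b :: l =>
    (chainRuns R (b :: l)).image (fun L => [a] :: L) ∪
      if R a b then (chainRuns R (b :: l)).image (List.modifyHead (a :: ·)) else ∅

theorem mem_chainRuns (R : α → α → Prop) [DecidableRel R] (l : List α) (L : List (List α)) :
    L ∈ chainRuns R l ↔ L.flatten = l ∧ ∀ r ∈ L, r ≠ [] ∧ r.IsChain R := by
  induction l using chainRuns.induct generalizing L with
  | case1 =>
    rcases L with _ | ⟨r, L⟩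
    · simp [chainRuns]
    · simp only [chainRuns, mem_singleton, List.flatten_cons, List.append_eq_nil_iff]
      constructor
      · simp
      · rintro ⟨⟨rfl, -⟩, h⟩
        exact absurd rfl (h [] (by simp)).1
  | case2 a =>
    simp only [chainRuns, mem_singleton]
    constructor
    · rintro rfl
      simp
    · rintro ⟨h, hL⟩
      rcases L with _ | ⟨r, L⟩
      · simp at h
      rcases r with _ | ⟨c, r⟩
      · exact absurd rfl (hL [] (by simp)).1
      simp only [List.flatten_cons, List.cons_append, List.cons.injEq,
        List.append_eq_nil_iff] at h
      obtain ⟨rfl, rfl, h⟩ := h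
      rcases L with _ | ⟨r, L⟩
      · rfl
      · have := (hL r (by simp)).1
        simp_all
  | case3 a b l ih =>
    have key : ∀ L : List (List α), L ∈ chainRuns R (a :: b :: l) ↔
        (∃ L' ∈ chainRuns R (b :: l), [a] :: L' = L) ∨
          (R a b ∧ ∃ L' ∈ chainRuns R (b :: l), List.modifyHead (a :: ·) L' = L) := by
      intro L
      by_cases h : R a b <;> simp [chainRuns, h]
    rw [key]
    simp only [ih]
    constructor
    · rintro (⟨L, ⟨h, hL⟩, rfl⟩ | ⟨hab, L, ⟨h, hL⟩, rfl⟩)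
      · refine ⟨by simp [h], ?_⟩
        simpa using hL
      · rcases L with _ | ⟨r, L⟩
        · simp at h
        rcases r with _ | ⟨c, r⟩
        · exact absurd rfl (hL [] (by simp)).1
        simp only [List.flatten_cons, List.cons_append, List.cons.injEq] at h
        obtain ⟨rfl, rfl⟩ := h
        simp only [List.mem_cons, forall_eq_or_imp] at hL
        refine ⟨by simp, ?_⟩
        simp only [List.modifyHead_cons, List.mem_cons, forall_eq_or_imp]
        exact ⟨⟨by simp, by simp [hab, hL.1.2]⟩, hL.2⟩
    · rintro ⟨h, hL⟩
      rcases L with _ | ⟨r, L⟩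
      · simp at h
      rcases r with _ | ⟨c, r⟩
      · exact absurd rfl (hL [] (by simp)).1
      simp only [List.flatten_cons, List.cons_append, List.cons.injEq] at h
      obtain ⟨rfl, h⟩ := h
      simp only [List.mem_cons, forall_eq_or_imp] at hL
      rcases r with _ | ⟨d, r⟩
      · exact Or.inl ⟨L, ⟨by simpa using h, hL.2⟩, rfl⟩
      · simp only [List.cons_append, List.cons.injEq] at h
        obtain ⟨rfl, h⟩ := h
        have hc := hL.1.2
        rw [List.isChain_cons_cons] at hc
        refine Or.inr ⟨hc.1, (d :: r) :: L, ⟨by simp [h], ?_⟩, rfl⟩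
        simp only [List.mem_cons, forall_eq_or_imp]
        exact ⟨⟨by simp, hc.2⟩, hL.2⟩

theorem ne_nil_of_mem_chainRuns_cons {R : α → α → Prop} [DecidableRel R] {a : α} {l : List α}
    {L : List (List α)} (h : L ∈ chainRuns R (a :: l)) :
    ∃ b r L', L = (b :: r) :: L' := by
  rw [mem_chainRuns] at h
  rcases L with _ | ⟨_ | ⟨b, r⟩, L'⟩
  · simp at h
  · exact absurd rfl (h.2 [] (by simp)).1
  · exact ⟨b, r, L', rfl⟩

theorem sum_chainRuns_cons_cons (R : α → α → Prop) [DecidableRel R] (a b : α) (l : List α)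
    (f : ℕ → ℝ) :
    ∑ L ∈ chainRuns R (a :: b :: l), f L.length =
      ∑ L ∈ chainRuns R (b :: l), f (L.length + 1) +
        if R a b then ∑ L ∈ chainRuns R (b :: l), f L.length else 0 := by
  have h1 : ∑ L ∈ (chainRuns R (b :: l)).image (fun L => [a] :: L), f L.length =
      ∑ L ∈ chainRuns R (b :: l), f (L.length + 1) := by
    rw [sum_image (by intro x _ y _ h; simpa using h)]
    simp
  by_cases hab : R a b
  · simp only [chainRuns, hab, if_true]
    rw [sum_union, h1, sum_image]
    · simp
    · intro x hx y hy h
      obtain ⟨c, r, x, rfl⟩ := ne_nil_of_mem_chainRuns_cons hx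
      obtain ⟨d, t, y, rfl⟩ := ne_nil_of_mem_chainRuns_cons hy
      simpa using h
    · rw [disjoint_left]
      simp only [mem_image, not_exists, not_and]
      rintro _ ⟨L, hL, rfl⟩ L' hL' h
      obtain ⟨c, r, x, rfl⟩ := ne_nil_of_mem_chainRuns_cons hL'
      simp at h
  · simp only [chainRuns, hab, if_false, union_empty, add_zero]
    exact h1

theorem ascL_cons_cons (a b : ℕ) (l : List ℕ) :
    ascL (a :: b :: l) = ascL (b :: l) + if a < b then 1 else 0 := by
  by_cases h : a < b <;> simp [ascL, h]

theorem ascL_cons_le (a : ℕ) (l : List ℕ) : ascL (a :: l) ≤ l.length := by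
  unfold ascL
  refine (List.length_filter_le _ _).trans ?_
  simp

theorem sum_chainRuns_lt (m : α → ℕ) (a : α) (l : List α) (j p c : ℕ)
    (hc : ascL ((a :: l).map m) = c) (hp : p + c = l.length) :
    ∑ L ∈ chainRuns (fun x y => m x < m y) (a :: l),
        (-1 : ℝ) ^ (L.length + j - 1) / ((L.length + j : ℕ) : ℝ) =
      (-1 : ℝ) ^ (p + j) * (c.factorial * (p + j).factorial) / (p + c + j + 1).factorial := by
  induction l generalizing a j p c with
  | nil =>
    obtain ⟨rfl, rfl⟩ : p = 0 ∧ c = 0 := by simpa using hp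
    simp only [chainRuns, sum_singleton, List.length_singleton]
    rw [show 1 + j - 1 = 0 + j by omega, show 1 + j = j + 1 by omega,
      show 0 + 0 + j + 1 = j + 1 by omega, Nat.factorial_succ, zero_add]
    have : (j.factorial : ℝ) ≠ 0 := by positivity
    push_cast
    field_simp
    simp
  | cons b l ih =>
    have hle := ascL_cons_le (m b) (l.map m)
    rw [List.length_map] at hle
    rw [sum_chainRuns_cons_cons _ a b l
      (fun k => (-1 : ℝ) ^ (k + j - 1) / ((k + j : ℕ) : ℝ))]
    simp only [List.map_cons, ascL_cons_cons] at hc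
    have shift : ∀ k : ℕ, k + 1 + j = k + (j + 1) := fun k => by omega
    simp only [shift]
    simp only [List.length_cons] at hp
    by_cases hab : m a < m b
    · simp only [hab, if_true] at hc ⊢
      obtain ⟨c, rfl⟩ : ∃ d, c = d + 1 := ⟨_, hc.symm⟩
      have hc' : ascL ((b :: l).map m) = c := by simpa using hc
      rw [ih b (j + 1) p c hc' (by omega), ih b j p c hc' (by omega)]
      rw [show p + (j + 1) = p + j + 1 by omega,
        show p + c + (j + 1) + 1 = p + c + j + 1 + 1 by omega,
        show p + (c + 1) + j + 1 = p + c + j + 1 + 1 by omega,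
        Nat.factorial_succ (p + c + j + 1), Nat.factorial_succ (p + j), Nat.factorial_succ c]
      have : ((p + c + j + 1).factorial : ℝ) ≠ 0 := by positivity
      push_cast
      field_simp
      ring
    · simp only [hab, if_false, add_zero] at hc ⊢
      obtain ⟨p, rfl⟩ : ∃ q, p = q + 1 := by
        refine ⟨p - 1, ?_⟩
        omega
      rw [ih b (j + 1) p c hc (by omega)]
      rw [show p + 1 + j = p + (j + 1) by omega,
        show p + 1 + c + j + 1 = p + c + (j + 1) + 1 by omega]

theorem sum_chainRuns_lt_eq (m : α → ℕ) (l : List α) (hl : l ≠ []) :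
    ∑ L ∈ chainRuns (fun x y => m x < m y) l, (-1 : ℝ) ^ (L.length - 1) / (L.length : ℝ) =
      (-1 : ℝ) ^ (l.length - ascL (l.map m) - 1) /
        ((l.length : ℝ) * (Nat.choose (l.length - 1) (ascL (l.map m)) : ℝ)) := by
  obtain ⟨a, l, rfl⟩ := List.exists_cons_of_ne_nil hl
  have hle : ascL ((a :: l).map m) ≤ l.length := by
    simpa using ascL_cons_le (m a) (l.map m)
  obtain ⟨p, hp⟩ := Nat.exists_eq_add_of_le' hle
  have h := sum_chainRuns_lt m a l 0 p _ rfl hp.symm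
  simp only [add_zero] at h
  rw [h]
  generalize ascL ((a :: l).map m) = c at *
  rw [List.length_cons, hp, show p + c + 1 - c - 1 = p by omega,
    show p + c + 1 - 1 = p + c by omega, Nat.factorial_succ,
    ← Nat.choose_mul_factorial_mul_factorial (Nat.le_add_left c p), Nat.add_sub_cancel]
  have h1 : ((p + c).choose c : ℝ) ≠ 0 := by
    exact_mod_cast (Nat.choose_pos (Nat.le_add_left c p)).ne'
  have h2 : (p.factorial : ℝ) ≠ 0 := by positivity
  have h3 : (c.factorial : ℝ) ≠ 0 := by positivity
  push_cast
  field_simp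

end ListRuns

section Weisner

variable {n : ℕ}

theorem mem_unionList {l : List (Block n)} {x : Fin n} :
    x ∈ unionList l ↔ ∃ P ∈ l, x ∈ P := by
  induction l with
  | nil => simp [unionList]
  | cons P l ih =>
    have : unionList (P :: l) = P ∪ unionList l := rfl
    simp [this, ih]

theorem mem_restrict {σ : List (Block n)} {P T : Block n} :
    T ∈ restrict σ P ↔ T.Nonempty ∧ ∃ Q ∈ σ, Q ∩ P = T := by
  simp [restrict, nonempty_iff_ne_empty, and_comm]

/-- The index of the block of `η` containing `T`. -/
def containIdx (η : List (Block n)) (T : Block n) : ℕ :=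
  η.findIdx (fun E => decide (T ⊆ E))

theorem IsOSP.containIdx_eq {η : List (Block n)} {E : Block n} (hη : IsOSP E η) {T : Block n}
    (hT : T.Nonempty) {i : ℕ} (hi : i < η.length) (h : T ⊆ η[i]) : containIdx η T = i := by
  unfold containIdx
  rw [List.findIdx_eq hi]
  refine ⟨by simpa using h, fun j hj => ?_⟩
  obtain ⟨x, hx⟩ := hT
  have hd := List.pairwise_iff_getElem.1 hη.2.1 j i (by omega) hi hj
  simp only [decide_eq_false_iff_not]
  exact fun hT' => disjoint_left.1 hd (hT' hx) (h hx)

theorem IsOSP.pairwise_restrict {η : List (Block n)} {E : Block n} (hη : IsOSP E η)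
    (P : Block n) : (restrict η P).Pairwise (fun S T => containIdx η S < containIdx η T) := by
  unfold restrict
  rw [List.pairwise_filter, List.pairwise_map, List.pairwise_iff_getElem]
  intro i j hi hj hij h1 h2
  simp only [decide_eq_true_eq, ← nonempty_iff_ne_empty] at h1 h2
  rw [hη.containIdx_eq h1 hi inter_subset_left, hη.containIdx_eq h2 hj inter_subset_left]
  exact hij

theorem IsOSP.unionList_restrict {η : List (Block n)} (hη : IsOSP univ η) (P : Block n) :
    unionList (restrict η P) = P := by
  ext x
  simp only [mem_unionList, mem_restrict]
  constructor
  · rintro ⟨_, ⟨-, Q, -, rfl⟩, hx⟩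
    exact (mem_inter.1 hx).2
  · intro hx
    obtain ⟨Q, hQ, hxQ⟩ := hη.2.2.2 x (mem_univ x)
    have hxQP := mem_inter.2 ⟨hxQ, hx⟩
    exact ⟨Q ∩ P, ⟨⟨x, hxQP⟩, Q, hQ, rfl⟩, hxQP⟩

theorem IsOSP.eq_of_mem_of_mem {η : List (Block n)} {E : Block n} (hη : IsOSP E η)
    {S T : Block n} (hS : S ∈ η) (hT : T ∈ η) {x : Fin n} (hxS : x ∈ S) (hxT : x ∈ T) :
    S = T := by
  by_contra hne
  exact disjoint_left.1 (hη.2.1.forall hS hT hne) hxS hxT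

theorem IsOSP.restrict_unionList {η r : List (Block n)} (hη : IsOSP univ η)
    (hne : ∀ T ∈ r, T.Nonempty) (hsub : ∀ T ∈ r, ∃ E ∈ η, T ⊆ E)
    (hr : r.Pairwise (fun S T => containIdx η S < containIdx η T)) :
    restrict η (unionList r) = r := by
  have hP := hη.pairwise_restrict (unionList r)
  have inter_eq : ∀ T ∈ r, ∀ E ∈ η, T ⊆ E → E ∩ unionList r = T := by
    intro T hT E hE hTE
    ext x
    simp only [mem_inter, mem_unionList]
    refine ⟨?_, fun hx => ⟨hTE hx, T, hT, hx⟩⟩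
    rintro ⟨hxE, S, hS, hxS⟩
    by_contra hxT
    obtain ⟨F, hF, hSF⟩ := hsub S hS
    obtain rfl := hη.eq_of_mem_of_mem hE hF hxE (hSF hxS)
    have hST : S ≠ T := by
      rintro rfl
      exact hxT hxS
    obtain ⟨i, hi, rfl⟩ := List.getElem_of_mem hE
    have h1 := hη.containIdx_eq (hne S hS) hi hSF
    have h2 := hη.containIdx_eq (hne T hT) hi hTE
    have : Std.Symm (fun S T : Block n => containIdx η S ≠ containIdx η T) :=
      ⟨fun _ _ h => h.symm⟩
    have := List.Pairwise.forall
      (hr.imp fun h => (ne_of_lt h : containIdx η _ ≠ containIdx η _)) hS hT hST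
    omega
  refine List.Perm.eq_of_pairwise (fun S T _ _ h h' => absurd h' (lt_asymm h)) hP hr ?_
  rw [List.perm_ext_iff_of_nodup (hP.imp fun h => by rintro rfl; exact lt_irrefl _ h)
    (hr.imp fun h => by rintro rfl; exact lt_irrefl _ h)]
  intro T
  rw [mem_restrict]
  constructor
  · rintro ⟨⟨x, hx⟩, E, hE, rfl⟩
    obtain ⟨hxE, hxr⟩ := mem_inter.1 hx
    obtain ⟨S, hS, hxS⟩ := mem_unionList.1 hxr
    obtain ⟨F, hF, hSF⟩ := hsub S hS
    obtain rfl := hη.eq_of_mem_of_mem hE hF hxE (hSF hxS)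
    rwa [inter_eq S hS E hE hSF]
  · intro hT
    obtain ⟨E, hE, hTE⟩ := hsub T hT
    exact ⟨hne T hT, E, hE, inter_eq T hT E hE hTE⟩

theorem refines_qmeet (σ η : List (Block n)) : refines (qmeet σ η) η := by
  intro T hT
  simp only [qmeet, List.mem_flatten, List.mem_map] at hT
  obtain ⟨_, ⟨P, -, rfl⟩, hT⟩ := hT
  obtain ⟨-, Q, hQ, rfl⟩ := mem_restrict.1 hT
  exact ⟨Q, hQ, inter_subset_left⟩

theorem muR_univ {σ : List (Block n)} (hσ : ∀ P ∈ σ, P.Nonempty) :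
    muR σ [univ] = (-1 : ℝ) ^ (σ.length - 1) / (σ.length : ℝ) := by
  have : restrict σ univ = σ := by
    simp only [restrict, inter_univ, List.map_id']
    rw [List.filter_eq_self]
    intro P hP
    simpa using (hσ P hP).ne_empty
  simp [muR, colonNum, this]

section Fibre

variable {τ η : List (Block n)}

theorem map_restrict_map_unionList (hτ : IsOSP univ τ) (hη : IsOSP univ η) (hτη : refines τ η)
    {L : List (List (Block n))}
    (hL : L ∈ chainRuns (fun S T => containIdx η S < containIdx η T) τ) :
    (L.map unionList).map (restrict η) = L := by
  rw [mem_chainRuns] at hL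
  obtain ⟨rfl, hL⟩ := hL
  rw [List.map_map]
  conv_rhs => rw [← List.map_id L]
  refine List.map_congr_left fun r hr => ?_
  refine hη.restrict_unionList (fun T hT => hτ.1 T (List.mem_flatten.2 ⟨r, hr, hT⟩))
    (fun T hT => hτη T (List.mem_flatten.2 ⟨r, hr, hT⟩)) ?_
  have : IsTrans (Block n) (fun S T => containIdx η S < containIdx η T) :=
    ⟨fun _ _ _ => lt_trans⟩
  exact List.isChain_iff_pairwise.1 (hL r hr).2

theorem isOSP_map_unionList (hτ : IsOSP univ τ) {L : List (List (Block n))}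
    (hflat : L.flatten = τ) (hL : ∀ r ∈ L, r ≠ []) : IsOSP univ (L.map unionList) := by
  subst hflat
  refine ⟨?_, ?_, fun P _ => subset_univ P, ?_⟩
  · intro P hP
    obtain ⟨r, hr, rfl⟩ := List.mem_map.1 hP
    obtain ⟨T, hT⟩ := List.exists_mem_of_ne_nil r (hL r hr)
    obtain ⟨x, hx⟩ := hτ.1 T (List.mem_flatten.2 ⟨r, hr, hT⟩)
    exact ⟨x, mem_unionList.2 ⟨T, hT, hx⟩⟩
  · rw [List.pairwise_map]
    refine (List.pairwise_flatten.1 hτ.2.1).2.imp fun {r t} h => ?_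
    rw [disjoint_left]
    intro x hx hx'
    obtain ⟨S, hS, hxS⟩ := mem_unionList.1 hx
    obtain ⟨T, hT, hxT⟩ := mem_unionList.1 hx'
    exact disjoint_left.1 (h S hS T hT) hxS hxT
  · intro x hx
    obtain ⟨T, hT, hxT⟩ := hτ.2.2.2 x hx
    obtain ⟨r, hr, hTr⟩ := List.mem_flatten.1 hT
    exact ⟨unionList r, List.mem_map_of_mem hr, mem_unionList.2 ⟨T, hTr, hxT⟩⟩

/-- The ordered set partitions with quasi-meet `τ` against `η` are obtained by merging the pieces
of a cutting of `τ` into `η`-ascending runs. -/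
theorem setOf_qmeet_eq (hτ : IsOSP univ τ) (hη : IsOSP univ η) (hτη : refines τ η) :
    {σ : List (Block n) | IsOSP univ σ ∧ qmeet σ η = τ} =
      ((chainRuns (fun S T => containIdx η S < containIdx η T) τ).image
        (List.map unionList) : Finset (List (Block n))) := by
  ext σ
  simp only [Set.mem_ofPred_eq, coe_image, Set.mem_image, mem_coe]
  constructor
  · rintro ⟨hσ, rfl⟩
    refine ⟨σ.map (restrict η), (mem_chainRuns _ _ _).2 ⟨rfl, ?_⟩, ?_⟩
    · intro r hr
      obtain ⟨P, hP, rfl⟩ := List.mem_map.1 hr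
      refine ⟨fun h => ?_, (hη.pairwise_restrict P).isChain⟩
      have hu := hη.unionList_restrict P
      rw [h] at hu
      exact (hσ.1 P hP).ne_empty hu.symm
    · rw [List.map_map]
      conv_rhs => rw [← List.map_id σ]
      exact List.map_congr_left fun P _ => hη.unionList_restrict P
  · rintro ⟨L, hL, rfl⟩
    have hmap := map_restrict_map_unionList hτ hη hτη hL
    rw [mem_chainRuns] at hL
    refine ⟨isOSP_map_unionList hτ hL.1 fun r hr => (hL.2 r hr).1, ?_⟩
    rw [← hL.1]
    exact congrArg List.flatten hmap

end Fibre

end Weisner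

/-- For all `τ, η ∈ OP_n` (`n ≥ 1`), the Weisner coefficient satisfies
`w(τ,η) = (−1)^{|τ|−asc_η(τ)−1} / (|τ|·C(|τ|−1, asc_η(τ)))` if `τ̄ ≤ η̄`, and `w(τ,η) = 0`
otherwise. -/
theorem statement12 {n : ℕ} (hn : 1 ≤ n) (τ η : List (Block n))
    (hτ : IsOSP Finset.univ τ) (hη : IsOSP Finset.univ η) :
    (refines τ η →
      wcoef τ η = (-1 : ℝ) ^ (τ.length - ascN τ η - 1) /
        ((τ.length : ℝ) * (Nat.choose (τ.length - 1) (ascN τ η) : ℝ))) ∧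
    (¬ refines τ η → wcoef τ η = 0) := by
  constructor
  · intro hτη
    have hne : τ ≠ [] := by
      rintro rfl
      obtain ⟨P, hP, -⟩ := hτ.2.2.2 ⟨0, hn⟩ (mem_univ _)
      simp at hP
    unfold wcoef
    rw [setOf_qmeet_eq hτ hη hτη, finsum_mem_coe_finset, sum_image]
    · refine Eq.trans (sum_congr rfl fun L hL => ?_)
        (sum_chainRuns_lt_eq (containIdx η) τ hne)
      rw [mem_chainRuns] at hL
      rw [muR_univ (isOSP_map_unionList hτ hL.1 fun r hr => (hL.2 r hr).1).1, List.length_map]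
    · intro L hL L' hL' h
      rw [← map_restrict_map_unionList hτ hη hτη hL, h,
        map_restrict_map_unionList hτ hη hτη hL']
  · intro hτη
    have hempty : {σ : List (Block n) | IsOSP univ σ ∧ qmeet σ η = τ} = ∅ := by
      refine Set.eq_empty_of_forall_notMem ?_
      rintro σ ⟨-, rfl⟩
      exact hτη (refines_qmeet σ η)
    unfold wcoef
    rw [hempty, finsum_mem_empty]

end OSPpaper
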